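/- Let h₁, …, hₙ (n ≥ 1) be nonempty reduced words over Ã, generating the subgroup H of F(A), and let ℓ = |h₁| + ⋯ + |hₙ|. Then there exists a reduced inverse automaton 𝒜 over Ã with L(𝒜)ρ = H and with at most ℓ − n + 1 states; it is obtained by reducing the automaton produced from the one-state automaton ({q₀}, q₀, ∅) by performing successively the expansions by (q₀, hᵢ, q₀) for 1 ≤ i ≤ n. -/

import Mathlib

open Function

/-- A letter of the symmetrized alphabet Ã: `(a, true)` stands for `a ∈ A` and
`(a, false)` for `a⁻¹ ∈ A⁻¹`. -/
abbrev Ltr (A : Type) := A × Bool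

/-- Inversion of letters of Ã. -/
def Ltr.inv {A : Type} (x : Ltr A) : Ltr A := (x.1, !x.2)

/-- The inverse `u⁻¹` of a word `u` over Ã. -/
def wordInv {A : Type} (w : List (Ltr A)) : List (Ltr A) := (w.map Ltr.inv).reverse

/-- A word over Ã is reduced iff it has no factor of the form `a a⁻¹` or `a⁻¹ a`. -/
def IsReducedWord {A : Type} (w : List (Ltr A)) : Prop :=
  ∀ (u v : List (Ltr A)) (a : A) (b : Bool), w ≠ u ++ (a, b) :: (a, !b) :: v

/-- An automaton over the symmetrized alphabet Ã, with a bundled state type `Q`,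
an initial state `q0` and a set `E` of transitions. -/
structure Autom (A : Type) : Type 1 where
  Q : Type
  q0 : Q
  E : Set (Q × Ltr A × Q)

namespace Autom

variable {A : Type}

/-- Paths using only transitions in the set `T`. -/
inductive PathOn (M : Autom A) (T : Set (M.Q × Ltr A × M.Q)) :
    M.Q → List (Ltr A) → M.Q → Prop
  | nil (q : M.Q) : PathOn M T q [] q
  | cons {p q r : M.Q} {a : Ltr A} {w : List (Ltr A)} :
      (p, a, q) ∈ T → PathOn M T q w r → PathOn M T p (a :: w) r

/-- `M.Path p u q` : the word `u` labels a path from state `p` to state `q` in `M`. -/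
def Path (M : Autom A) : M.Q → List (Ltr A) → M.Q → Prop := M.PathOn M.E

/-- The language L(𝒜) of words labeling a path from `q0` to `q0`. -/
def lang (M : Autom A) : Set (List (Ltr A)) := {w | M.Path M.q0 w M.q0}

/-- The set L(𝒜)ρ of reductions (in the free group `F(A)`) of words of L(𝒜). -/
def langRho (M : Autom A) : Set (FreeGroup A) := FreeGroup.mk '' M.lang

/-- Dual automaton: `(p,a,q)` is an edge iff `(q,a⁻¹,p)` is one. -/
def Dual (M : Autom A) : Prop := ∀ p a q, (p, a, q) ∈ M.E ↔ (q, Ltr.inv a, p) ∈ M.E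

/-- Deterministic automaton. -/
def Deterministic (M : Autom A) : Prop :=
  ∀ p a q q', (p, a, q) ∈ M.E → (p, a, q') ∈ M.E → q = q'

/-- Trim automaton: every state lies on a path from `q0` to `q0`. -/
def Trim (M : Autom A) : Prop := ∀ q, ∃ u v, M.Path M.q0 u q ∧ M.Path q v M.q0

/-- Inverse automaton: deterministic, trim and dual. -/
def IsInv (M : Autom A) : Prop := M.Deterministic ∧ M.Trim ∧ M.Dual

/-- Reduced automaton: every state lies on a path from `q0` to `q0` labeled by
a reduced word. -/
def IsRed (M : Autom A) : Prop :=
  ∀ q, ∃ u v, IsReducedWord (u ++ v) ∧ M.Path M.q0 u q ∧ M.Path q v M.q0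

/-- Homomorphisms of automata. -/
def IsHom (M N : Autom A) (φ : M.Q → N.Q) : Prop :=
  φ M.q0 = N.q0 ∧ ∀ p a q, (p, a, q) ∈ M.E → (φ p, a, φ q) ∈ N.E

/-- Isomorphism of automata. -/
def Isomorphic (M N : Autom A) : Prop :=
  ∃ φ : M.Q ≃ N.Q, M.IsHom N φ ∧ N.IsHom M φ.symm

/-- `N` is (isomorphic to) the automaton obtained from `M` by identifying the two
states `p` and `q`. -/
def IsIdentification (M : Autom A) (p q : M.Q) (N : Autom A) : Prop :=
  ∃ φ : M.Q → N.Q,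
    Surjective φ ∧ φ M.q0 = N.q0 ∧
    (∀ x y, φ x = φ y ↔ x = y ∨ (x = p ∧ y = q) ∨ (x = q ∧ y = p)) ∧
    (∀ e : N.Q × Ltr A × N.Q, e ∈ N.E ↔ ∃ e' ∈ M.E, e = (φ e'.1, e'.2.1, φ e'.2.2))

/-- `N` is (isomorphic to) the automaton obtained from `M` by deleting the state `q`
and all transitions involving it. -/
def IsDeletion (M : Autom A) (q : M.Q) (N : Autom A) : Prop :=
  ∃ φ : N.Q → M.Q,
    Injective φ ∧ Set.range φ = {x | x ≠ q} ∧ φ N.q0 = M.q0 ∧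
    (∀ e : N.Q × Ltr A × N.Q, e ∈ N.E ↔ (φ e.1, e.2.1, φ e.2.2) ∈ M.E)

/-- Elementary reduction of type 1. -/
def Red1 (M N : Autom A) : Prop :=
  ∃ p q r a, p ≠ q ∧ (r, a, p) ∈ M.E ∧ (r, a, q) ∈ M.E ∧ M.IsIdentification p q N

/-- Elementary reduction of type 2. -/
def Red2 (M N : Autom A) : Prop :=
  ∃ (p q : M.Q) (a : Ltr A), q ≠ M.q0 ∧ (p, a, q) ∈ M.E ∧ (q, Ltr.inv a, p) ∈ M.E ∧
    (∀ e ∈ M.E, e.1 = q ∨ e.2.2 = q → e = (p, a, q) ∨ e = (q, Ltr.inv a, p)) ∧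
    M.IsDeletion q N

/-- `N` is (isomorphic to) the reduction `Mρ` of `M`: perform elementary reductions
of type 1 until the automaton is deterministic, then elementary reductions of type 2
until none is possible. -/
def ReductionOf (M N : Autom A) : Prop :=
  ∃ M₁, Relation.ReflTransGen Red1 M M₁ ∧ M₁.Deterministic ∧
    Relation.ReflTransGen Red2 M₁ N ∧ ∀ N', ¬ Red2 N N'

/-- `N` is (isomorphic to) the expansion of `M` by `(p, w, q)`: a new path labeled `w`
from `p` to `q` (together with its inverse path) whose intermediate states are new. -/
def IsExpansion (M : Autom A) (p : M.Q) (w : List (Ltr A)) (q : M.Q) (N : Autom A) : Prop :=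
  w ≠ [] ∧
  ∃ (φ : M.Q → N.Q) (c : Fin (w.length + 1) → N.Q),
    Injective φ ∧ φ M.q0 = N.q0 ∧ c 0 = φ p ∧ c (Fin.last w.length) = φ q ∧
    (∀ i : Fin (w.length + 1), 0 < (i : ℕ) → (i : ℕ) < w.length → c i ∉ Set.range φ) ∧
    (∀ i j : Fin (w.length + 1), 0 < (i : ℕ) → (i : ℕ) < w.length → c i = c j → i = j) ∧
    (∀ x : N.Q, (∃ y, φ y = x) ∨ ∃ i, c i = x) ∧
    (∀ e : N.Q × Ltr A × N.Q, e ∈ N.E ↔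
      ((∃ e' ∈ M.E, e = (φ e'.1, e'.2.1, φ e'.2.2)) ∨
        ∃ i : Fin w.length,
          e = (c i.castSucc, w.get i, c i.succ) ∨
          e = (c i.succ, Ltr.inv (w.get i), c i.castSucc)))

/-- `M →exp^{(p,w,q)} N` : `N` is (isomorphic to) the reduction of the expansion
of `M` by `(p,w,q)`. -/
def ExpStep (M : Autom A) (p : M.Q) (w : List (Ltr A)) (q : M.Q) (N : Autom A) : Prop :=
  ∃ N' N'', M.IsExpansion p w q N' ∧ ReductionOf N' N'' ∧ Isomorphic N'' N

/-- `M →re^{(p,w,q)} N` : a reduced expansion, i.e. an expansion-then-reduction in which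
`M` embeds in `N`. -/
def REStep (M : Autom A) (p : M.Q) (w : List (Ltr A)) (q : M.Q) (N : Autom A) : Prop :=
  M.ExpStep p w q N ∧ ∃ ψ : M.Q → N.Q, Injective ψ ∧ M.IsHom N ψ

/-- `M →e^{w} N` : an e-step, i.e. `M →exp^{(q0,w,q0)} N`. -/
def EStep (M : Autom A) (w : List (Ltr A)) (N : Autom A) : Prop :=
  M.ExpStep M.q0 w M.q0 N

/-- `M →i^{p=q} N` : an i-step; `N` is (isomorphic to) the reduction of the automaton
obtained from `M` by identifying the distinct states `p` and `q`. -/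
def IStep (M : Autom A) (p q : M.Q) (N : Autom A) : Prop :=
  p ≠ q ∧ ∃ N' N'', M.IsIdentification p q N' ∧ ReductionOf N' N'' ∧ Isomorphic N'' N

/-- i-step, allowing `p = q` (in which case nothing happens). -/
def IStep' (M : Autom A) (p q : M.Q) (N : Autom A) : Prop :=
  (p = q ∧ M.Isomorphic N) ∨ M.IStep p q N

/-- `M →i N` : some i-step applies. -/
def IStepAny (M N : Autom A) : Prop := ∃ p q, M.IStep p q N

/-- Some reduced expansion (by a nonempty reduced word) applies. -/
def REStepAny (M N : Autom A) : Prop :=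
  ∃ p w q, IsReducedWord w ∧ M.REStep p w q N

/-- `M` is (isomorphic to) `Γ_A(H)` : a reduced inverse automaton with `L(M)ρ = H`. -/
def Represents (M : Autom A) (H : Subgroup (FreeGroup A)) : Prop :=
  M.IsInv ∧ M.IsRed ∧ M.langRho = ↑H

/-- The `q0`-diameter of an automaton: the maximum over all states `q` of the minimal
length of a reduced word labeling a path from `q0` to `q`. -/
noncomputable def diam (M : Autom A) : ℕ :=
  ⨆ q : M.Q, sInf {n | ∃ u, IsReducedWord u ∧ u.length = n ∧ M.Path M.q0 u q}

end Autom

/-- `S` is a basis of the subgroup `H`: `S` generates `H` and freely so. -/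
def IsFreeBasis {G : Type} [Group G] (S : Set G) (H : Subgroup G) : Prop :=
  Subgroup.closure S = H ∧
    Injective (FreeGroup.lift (Subtype.val : S → G) : FreeGroup S →* G)

/-- `H ≤ff K` : `H` is a free factor of `K`. -/
def FreeFactor {G : Type} [Group G] (H K : Subgroup G) : Prop :=
  ∃ B C : Set G, IsFreeBasis B H ∧ IsFreeBasis C K ∧ B ⊆ C

/-- The rank of a subgroup: the cardinality of a basis (the common value of
the cardinalities of all bases, when `H` is a finite-rank free group). -/
noncomputable def rk {G : Type} [Group G] (H : Subgroup G) : ℕ :=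
  sInf {n | ∃ S : Set G, IsFreeBasis S H ∧ S.ncard = n}

/-- `L` is a graphical free factor of `K` with respect to `A`: `Γ_A(L)` embeds
in `Γ_A(K)`. -/
def GraphicalFF {A : Type} (L K : Subgroup (FreeGroup A)) : Prop :=
  L ≤ K ∧ ∃ ML MK : Autom A, ML.Represents L ∧ MK.Represents K ∧
    ∃ ψ : ML.Q → MK.Q, Injective ψ ∧ ML.IsHom MK ψ

/-- A step (i-step or reduced expansion) from `M` to `N` of cost `c`. -/
def StepCost {A : Type} (M N : Autom A) (c : ℕ) : Prop :=
  (c = 0 ∧ Autom.IStepAny M N) ∨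
  (∃ p w q, IsReducedWord w ∧ w.length = c ∧ M.REStep p w q N)

/-- The well-order `≺` on cost sequences. -/
def costLT (k l : List ℕ) : Prop :=
  k.length < l.length ∨
  (k.length = l.length ∧ k.sum < l.sum) ∨
  (k.length = l.length ∧ k.sum = l.sum ∧ List.Lex (· < ·) k l)

namespace Autom

variable {A : Type}

theorem inv_inv' (a : Ltr A) : Ltr.inv (Ltr.inv a) = a := by
  simp [Ltr.inv]

theorem isReducedWord_iff (w : List (Ltr A)) :
    IsReducedWord w ↔ List.IsChain (fun x y => y ≠ Ltr.inv x) w := by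
  rw [List.isChain_iff_forall_rel_of_append_cons_cons]
  constructor
  · intro h x y u v e he
    exact h u v x.1 x.2 (by rw [e, he]; rfl)
  · intro h u v a b e
    exact h e rfl

theorem Path.nil {M : Autom A} (q : M.Q) : M.Path q [] q := PathOn.nil q

theorem Path.cons {M : Autom A} {p q r : M.Q} {a : Ltr A} {w : List (Ltr A)}
    (h : (p, a, q) ∈ M.E) (h' : M.Path q w r) : M.Path p (a :: w) r := PathOn.cons h h'

theorem path_nil_iff {M : Autom A} {p q : M.Q} : M.Path p [] q ↔ p = q := by
  constructor
  · intro h; cases h; rfl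
  · rintro rfl; exact Path.nil _

theorem path_cons_iff {M : Autom A} {p r : M.Q} {a : Ltr A} {w : List (Ltr A)} :
    M.Path p (a :: w) r ↔ ∃ q, (p, a, q) ∈ M.E ∧ M.Path q w r := by
  constructor
  · intro h; cases h with
    | cons h h' => exact ⟨_, h, h'⟩
  · rintro ⟨q, h, h'⟩; exact Path.cons h h'

theorem path_append_iff {M : Autom A} {u v : List (Ltr A)} : ∀ {p r : M.Q},
    M.Path p (u ++ v) r ↔ ∃ q, M.Path p u q ∧ M.Path q v r := by
  induction u with
  | nil => intro p r; simp [path_nil_iff]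
  | cons a u ih =>
    intro p r
    simp only [List.cons_append, path_cons_iff, ih]
    constructor
    · rintro ⟨q, h, s, h1, h2⟩; exact ⟨s, ⟨q, h, h1⟩, h2⟩
    · rintro ⟨s, ⟨q, h, h1⟩, h2⟩; exact ⟨q, h, s, h1, h2⟩

theorem path_inv {M : Autom A} (hd : M.Dual) {w : List (Ltr A)} : ∀ {p q : M.Q},
    M.Path p w q → M.Path q (wordInv w) p := by
  induction w with
  | nil => intro p q h; rw [path_nil_iff] at h; subst h; exact Path.nil _
  | cons a w ih =>
    intro p q h
    obtain ⟨s, h1, h2⟩ := path_cons_iff.1 h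
    have : wordInv (a :: w) = wordInv w ++ [Ltr.inv a] := by simp [wordInv]
    rw [this, path_append_iff]
    exact ⟨s, ih h2, path_cons_iff.2 ⟨p, (hd _ _ _).1 h1, Path.nil _⟩⟩

theorem mk_wordInv (w : List (Ltr A)) :
    FreeGroup.mk (wordInv w) = (FreeGroup.mk w)⁻¹ := by
  rw [FreeGroup.inv_mk]; rfl

theorem path_map {M N : Autom A} (φ : M.Q → N.Q)
    (hφ : ∀ p a q, (p, a, q) ∈ M.E → (φ p, a, φ q) ∈ N.E) {w : List (Ltr A)} :
    ∀ {p q : M.Q}, M.Path p w q → N.Path (φ p) w (φ q) := by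
  induction w with
  | nil => intro p q h; rw [path_nil_iff] at h; subst h; exact Path.nil _
  | cons a w ih =>
    intro p q h
    obtain ⟨s, h1, h2⟩ := path_cons_iff.1 h
    exact Path.cons (hφ _ _ _ h1) (ih h2)

/-- The invariant maintained through expansions and reductions. -/
structure Good (H : Subgroup (FreeGroup A)) (M : Autom A) : Prop where
  dual : M.Dual
  conn : ∀ q, ∃ u, M.Path M.q0 u q
  fin : Finite M.Q
  tau : ∃ τ : M.Q → FreeGroup A ⧸ H, τ M.q0 = ((1 : FreeGroup A) : FreeGroup A ⧸ H) ∧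
    ∀ p a q, (p, a, q) ∈ M.E → τ q = (FreeGroup.mk [a])⁻¹ • τ p

theorem Good.trim {H : Subgroup (FreeGroup A)} {M : Autom A} (h : Good H M) : M.Trim := by
  intro q
  obtain ⟨u, hu⟩ := h.conn q
  exact ⟨u, _, hu, path_inv h.dual hu⟩

theorem Good.langRho_subset {H : Subgroup (FreeGroup A)} {M : Autom A} (h : Good H M) :
    M.langRho ⊆ H := by
  obtain ⟨τ, h0, hτ⟩ := h.tau
  have key : ∀ (w : List (Ltr A)) (p q : M.Q), M.Path p w q →
      τ q = (FreeGroup.mk w)⁻¹ • τ p := by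
    intro w
    induction w with
    | nil =>
      intro p q h; rw [path_nil_iff] at h; subst h
      rw [← FreeGroup.one_eq_mk]; simp
    | cons a w ih =>
      intro p q h
      obtain ⟨s, h1, h2⟩ := path_cons_iff.1 h
      have : FreeGroup.mk (a :: w) = FreeGroup.mk [a] * FreeGroup.mk w := by
        rw [FreeGroup.mul_mk]; rfl
      rw [ih _ _ h2, hτ _ _ _ h1, this, mul_inv_rev, mul_smul]
  rintro _ ⟨w, hw, rfl⟩
  have := key w _ _ hw
  rw [h0, MulAction.Quotient.smul_coe, QuotientGroup.eq, smul_eq_mul, mul_one, inv_one, one_mul,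
    inv_mem_iff] at this
  exact this

theorem langRho_closure {M : Autom A} (hd : M.Dual) {S : Set (FreeGroup A)}
    (hS : S ⊆ M.langRho) : (Subgroup.closure S : Set (FreeGroup A)) ⊆ M.langRho := by
  intro g hg
  induction hg using Subgroup.closure_induction with
  | mem x hx => exact hS hx
  | one => exact ⟨[], Path.nil _, rfl⟩
  | mul x y _ _ hx hy =>
    obtain ⟨u, hu, rfl⟩ := hx
    obtain ⟨v, hv, rfl⟩ := hy
    exact ⟨u ++ v, path_append_iff.2 ⟨_, hu, hv⟩, FreeGroup.mul_mk.symm⟩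
  | inv x _ hx =>
    obtain ⟨u, hu, rfl⟩ := hx
    exact ⟨_, path_inv hd hu, mk_wordInv u⟩

/-! Type 1 reductions -/

theorem Red1.good {H : Subgroup (FreeGroup A)} {M N : Autom A} (hr : Red1 M N)
    (h : Good H M) : Good H N := by
  obtain ⟨p, q, r, a, hpq, h1, h2, φ, hs, h0, hφ, hE⟩ := hr
  have hom : ∀ p a q, (p, a, q) ∈ M.E → (φ p, a, φ q) ∈ N.E := fun p a q h =>
    (hE _).2 ⟨_, h, rfl⟩
  refine ⟨?_, ?_, ?_, ?_⟩
  · have aux : ∀ x b y, (x, b, y) ∈ N.E → (y, Ltr.inv b, x) ∈ N.E := by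
      intro x b y hxy
      obtain ⟨⟨x', b', y'⟩, he, heq⟩ := (hE _).1 hxy
      simp only [Prod.mk.injEq] at heq
      obtain ⟨rfl, rfl, rfl⟩ := heq
      exact hom _ _ _ ((h.dual _ _ _).1 he)
    intro x b y
    exact ⟨aux _ _ _, fun h => by have := aux _ _ _ h; rwa [inv_inv'] at this⟩
  · intro x
    obtain ⟨y, rfl⟩ := hs x
    obtain ⟨u, hu⟩ := h.conn y
    exact ⟨u, h0 ▸ path_map φ hom hu⟩
  · have := h.fin
    exact Finite.of_surjective φ hs
  · obtain ⟨τ, t0, hτ⟩ := h.tau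
    have hpq' : τ p = τ q := by rw [hτ _ _ _ h1, hτ _ _ _ h2]
    have hfac : ∀ x y, φ x = φ y → τ x = τ y := by
      intro x y hxy
      rcases (hφ x y).1 hxy with rfl | ⟨rfl, rfl⟩ | ⟨rfl, rfl⟩
      · rfl
      · exact hpq'
      · exact hpq'.symm
    choose g hg using hs
    refine ⟨fun x => τ (g x), ?_, ?_⟩
    · rw [← t0]; exact hfac _ _ (by rw [hg, h0])
    · intro x b y hxy
      obtain ⟨⟨x', b', y'⟩, he, heq⟩ := (hE _).1 hxy
      simp only [Prod.mk.injEq] at heq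
      obtain ⟨rfl, rfl, rfl⟩ := heq
      simp only
      rw [hfac _ _ (hg (φ y')), hfac _ _ (hg (φ x'))]
      exact hτ _ _ _ he

theorem Red1.langRho {M N : Autom A} (hr : Red1 M N) : M.langRho ⊆ N.langRho := by
  obtain ⟨p, q, r, a, hpq, h1, h2, φ, hs, h0, hφ, hE⟩ := hr
  rintro _ ⟨w, hw, rfl⟩
  have := path_map (N := N) φ (fun p a q h => (hE _).2 ⟨_, h, rfl⟩) hw
  rw [h0] at this
  exact ⟨w, this, rfl⟩

theorem Red1.card_lt {M N : Autom A} [Finite M.Q] (hr : Red1 M N) :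
    Nat.card N.Q < Nat.card M.Q := by
  obtain ⟨p, q, r, a, hpq, h1, h2, φ, hs, h0, hφ, hE⟩ := hr
  have hle := Nat.card_le_card_of_surjective φ hs
  refine lt_of_le_of_ne hle fun he => hpq ?_
  have : Finite N.Q := Finite.of_surjective φ hs
  have hb := (Nat.bijective_iff_surjective_and_card φ).2 ⟨hs, he.symm⟩
  exact hb.1 ((hφ p q).2 (Or.inr (Or.inl ⟨rfl, rfl⟩)))

theorem exists_red1 {M : Autom A} {p q r : M.Q} {a : Ltr A} (hpq : p ≠ q)
    (h1 : (r, a, p) ∈ M.E) (h2 : (r, a, q) ∈ M.E) : ∃ N, Red1 M N := by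
  let s : Setoid M.Q :=
    { r := fun x y => x = y ∨ (x = p ∧ y = q) ∨ (x = q ∧ y = p)
      iseqv := ⟨fun x => Or.inl rfl, by grind, by grind⟩ }
  refine ⟨⟨Quotient s, Quotient.mk s M.q0,
    {e | ∃ e' ∈ M.E, e = (Quotient.mk s e'.1, e'.2.1, Quotient.mk s e'.2.2)}⟩,
    p, q, r, a, hpq, h1, h2, Quotient.mk s, Quotient.mk_surjective, rfl, ?_, ?_⟩
  · intro x y
    exact Quotient.eq
  · intro e
    rfl

theorem exists_det {H : Subgroup (FreeGroup A)} : ∀ (k : ℕ) (M : Autom A), Nat.card M.Q = k →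
    Good H M → ∃ N, Relation.ReflTransGen Red1 M N ∧ N.Deterministic ∧ Good H N ∧
      M.langRho ⊆ N.langRho ∧ Nat.card N.Q ≤ Nat.card M.Q := by
  intro k
  induction k using Nat.strong_induction_on with
  | _ k ih =>
    intro M hk hM
    by_cases hdet : M.Deterministic
    · exact ⟨M, .refl, hdet, hM, subset_rfl, le_rfl⟩
    · unfold Deterministic at hdet
      push Not at hdet
      obtain ⟨r, a, p, q, h1, h2, hpq⟩ := hdet
      obtain ⟨N, hN⟩ := exists_red1 hpq h1 h2
      have := hM.fin
      have hlt := hN.card_lt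
      obtain ⟨B, b1, b2, b3, b4, b5⟩ := ih _ (hk ▸ hlt) N rfl (hN.good hM)
      exact ⟨B, .head hN b1, b2, b3, hN.langRho.trans b4, b5.trans hlt.le⟩

/-! Type 2 reductions -/

theorem del_path {M N : Autom A} {p q : M.Q} {a : Ltr A}
    (honly : ∀ e ∈ M.E, e.1 = q ∨ e.2.2 = q → e = (p, a, q) ∨ e = (q, Ltr.inv a, p))
    (φ : N.Q → M.Q) (hinj : Injective φ) (hrange : Set.range φ = {x | x ≠ q})
    (hE : ∀ e : N.Q × Ltr A × N.Q, e ∈ N.E ↔ (φ e.1, e.2.1, φ e.2.2) ∈ M.E) :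
    ∀ (k : ℕ) (w : List (Ltr A)), w.length = k → ∀ (x y : N.Q), M.Path (φ x) w (φ y) →
      ∃ w', N.Path x w' y ∧ FreeGroup.mk w' = FreeGroup.mk w := by
  have hne : ∀ x, φ x ≠ q := fun x => by
    have : φ x ∈ Set.range φ := ⟨x, rfl⟩
    rwa [hrange] at this
  intro k
  induction k using Nat.strong_induction_on with
  | _ k ih =>
    intro w hk x y hp
    cases w with
    | nil =>
      rw [path_nil_iff] at hp
      exact ⟨[], path_nil_iff.2 (hinj hp), rfl⟩
    | cons b w =>
      obtain ⟨s, h1, h2⟩ := path_cons_iff.1 hp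
      by_cases hs : s = q
      · subst hs
        cases w with
        | nil => rw [path_nil_iff] at h2; exact absurd h2.symm (hne y)
        | cons c w =>
          obtain ⟨t, h3, h4⟩ := path_cons_iff.1 h2
          rcases honly _ h1 (Or.inr rfl) with he | he
          · simp only [Prod.mk.injEq] at he
            obtain ⟨hx, rfl, -⟩ := he
            have ht : c = Ltr.inv b ∧ t = φ x := by
              rcases honly _ h3 (Or.inl rfl) with he | he
              · simp only [Prod.mk.injEq] at he
                exact absurd (hx.trans he.1.symm) (hne x)
              · simp only [Prod.mk.injEq] at he
                exact ⟨he.2.1, he.2.2.trans hx.symm⟩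
            obtain ⟨rfl, rfl⟩ := ht
            obtain ⟨w', hw', hm⟩ := ih w.length (by simp at hk; omega) w rfl x y h4
            refine ⟨w', hw', ?_⟩
            rw [hm]
            have e1 : FreeGroup.mk (b :: Ltr.inv b :: w) =
                FreeGroup.mk [b] * FreeGroup.mk (wordInv [b]) * FreeGroup.mk w := by
              rw [FreeGroup.mul_mk, FreeGroup.mul_mk]; rfl
            rw [e1, mk_wordInv, mul_inv_cancel, one_mul]
          · simp only [Prod.mk.injEq] at he
            exact absurd he.1 (hne x)
      · have : s ∈ Set.range φ := by rw [hrange]; exact hs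
        obtain ⟨s, rfl⟩ := this
        obtain ⟨w', hw', hm⟩ := ih w.length (by simp at hk; omega) w rfl s y h2
        refine ⟨b :: w', Path.cons ((hE _).2 h1) hw', ?_⟩
        have e1 : ∀ v, FreeGroup.mk (b :: v) = FreeGroup.mk [b] * FreeGroup.mk v := by
          intro v; rw [FreeGroup.mul_mk]; rfl
        rw [e1, e1 w, hm]

theorem Red2.good {H : Subgroup (FreeGroup A)} {M N : Autom A} (hr : Red2 M N)
    (h : Good H M) : Good H N := by
  obtain ⟨p, q, a, hq, h1, h2, honly, φ, hinj, hrange, h0, hE⟩ := hr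
  refine ⟨?_, ?_, ?_, ?_⟩
  · intro x b y
    rw [hE, hE]
    exact h.dual _ _ _
  · intro x
    obtain ⟨u, hu⟩ := h.conn (φ x)
    rw [← h0] at hu
    obtain ⟨w', hw', -⟩ := del_path honly φ hinj hrange hE _ u rfl _ _ hu
    exact ⟨w', hw'⟩
  · have := h.fin
    exact Finite.of_injective φ hinj
  · obtain ⟨τ, t0, hτ⟩ := h.tau
    exact ⟨fun x => τ (φ x), by simp only [h0, t0], fun x b y hxy => hτ _ _ _ ((hE _).1 hxy)⟩

theorem Red2.langRho {M N : Autom A} (hr : Red2 M N) : M.langRho ⊆ N.langRho := by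
  obtain ⟨p, q, a, hq, h1, h2, honly, φ, hinj, hrange, h0, hE⟩ := hr
  rintro _ ⟨w, hw, rfl⟩
  have hw : M.Path M.q0 w M.q0 := hw
  rw [← h0] at hw
  obtain ⟨w', hw', hm⟩ := del_path honly φ hinj hrange hE _ w rfl _ _ hw
  exact ⟨w', hw', hm⟩

theorem Red2.det {M N : Autom A} (hr : Red2 M N) (h : M.Deterministic) : N.Deterministic := by
  obtain ⟨p, q, a, hq, h1, h2, honly, φ, hinj, hrange, h0, hE⟩ := hr
  intro x b y y' hy hy'
  exact hinj (h _ _ _ _ ((hE _).1 hy) ((hE _).1 hy'))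

theorem Red2.card_lt {M N : Autom A} [Finite M.Q] (hr : Red2 M N) :
    Nat.card N.Q < Nat.card M.Q := by
  obtain ⟨p, q, a, hq, h1, h2, honly, φ, hinj, hrange, h0, hE⟩ := hr
  have hle := Nat.card_le_card_of_injective φ hinj
  refine lt_of_le_of_ne hle fun he => ?_
  have hb := (Nat.bijective_iff_injective_and_card φ).2 ⟨hinj, he⟩
  obtain ⟨x, hx⟩ := hb.2 q
  have : φ x ∈ Set.range φ := ⟨x, rfl⟩
  rw [hrange] at this
  exact this hx

theorem exists_core {H : Subgroup (FreeGroup A)} : ∀ (k : ℕ) (M : Autom A), Nat.card M.Q = k →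
    Good H M → M.Deterministic → ∃ N, Relation.ReflTransGen Red2 M N ∧ N.Deterministic ∧
      Good H N ∧ M.langRho ⊆ N.langRho ∧ Nat.card N.Q ≤ Nat.card M.Q ∧ ∀ N', ¬ Red2 N N' := by
  intro k
  induction k using Nat.strong_induction_on with
  | _ k ih =>
    intro M hk hM hd
    by_cases hred : ∃ N, Red2 M N
    · obtain ⟨N, hN⟩ := hred
      have := hM.fin
      have hlt := hN.card_lt
      obtain ⟨B, b1, b2, b3, b4, b5, b6⟩ := ih _ (hk ▸ hlt) N rfl (hN.good hM) (hN.det hd)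
      exact ⟨B, .head hN b1, b2, b3, hN.langRho.trans b4, b5.trans hlt.le, b6⟩
    · exact ⟨M, .refl, hd, hM, subset_rfl, le_rfl, fun N' h' => hred ⟨N', h'⟩⟩

/-! Automata with no type 2 reduction are reduced -/

theorem exists_succ {M : Autom A} (hd : M.Dual) (hdet : M.Deterministic)
    (hno : ∀ N, ¬ Red2 M N) {p q : M.Q} {a : Ltr A} (he : (p, a, q) ∈ M.E) (hq : q ≠ M.q0) :
    ∃ b r, (q, b, r) ∈ M.E ∧ b ≠ Ltr.inv a := by
  by_contra hcon
  push Not at hcon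
  have he' := (hd _ _ _).1 he
  have hout : ∀ b r, (q, b, r) ∈ M.E → b = Ltr.inv a ∧ r = p := by
    intro b r hb
    have hba := hcon b r hb
    subst hba
    exact ⟨rfl, hdet _ _ _ _ hb he'⟩
  refine hno ⟨{x : M.Q // x ≠ q}, ⟨M.q0, hq.symm⟩, {e | (e.1.1, e.2.1, e.2.2.1) ∈ M.E}⟩
    ⟨p, q, a, hq, he, he', ?_, Subtype.val, Subtype.val_injective, Subtype.range_val, rfl,
      fun e => Iff.rfl⟩
  rintro ⟨x, b, y⟩ hxy (hx | hy)
  · simp only at hx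
    subst hx
    obtain ⟨rfl, rfl⟩ := hout _ _ hxy
    exact Or.inr rfl
  · simp only at hy
    subst hy
    obtain ⟨hb, rfl⟩ := hout _ _ ((hd _ _ _).1 hxy)
    left
    have : b = a := by rw [← inv_inv' b, hb, inv_inv']
    rw [this]

/-- A directed edge from which the initial state can be reached without backtracking. -/
def GoodEdge (M : Autom A) (e : M.Q × Ltr A × M.Q) : Prop :=
  ∃ w, List.IsChain (fun x y => y ≠ Ltr.inv x) (e.2.1 :: w) ∧ M.Path e.2.2 w M.q0

theorem goodEdge_of_succ {M : Autom A} {p q r : M.Q} {a b : Ltr A}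
    (hb : (q, b, r) ∈ M.E) (hab : b ≠ Ltr.inv a) (hg : M.GoodEdge (q, b, r)) :
    M.GoodEdge (p, a, q) := by
  obtain ⟨w, h1, h2⟩ := hg
  exact ⟨b :: w, List.isChain_cons_cons.2 ⟨hab, h1⟩, Path.cons hb h2⟩

theorem inv_injective {a b : Ltr A} (h : Ltr.inv a = Ltr.inv b) : a = b := by
  rw [← inv_inv' a, h, inv_inv']

theorem goodEdge_of_inv {M : Autom A} [Finite M.Q] (hd : M.Dual) (hdet : M.Deterministic)
    (hno : ∀ N, ¬ Red2 M N) {p q : M.Q} {a : Ltr A} (he : (p, a, q) ∈ M.E)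
    (hg : M.GoodEdge (q, Ltr.inv a, p)) : M.GoodEdge (p, a, q) := by
  by_contra hbad
  let S : Set (M.Q × Ltr A × M.Q) :=
    {e | e ∈ M.E ∧ ¬ M.GoodEdge e ∧ M.GoodEdge (e.2.2, Ltr.inv e.2.1, e.1)}
  have hinj : ∀ e ∈ S, ∀ e' ∈ S, e.2.2 = e'.2.2 → e = e' := by
    rintro ⟨x, b, y⟩ ⟨h1, h2, h3⟩ ⟨x', b', y'⟩ ⟨h1', h2', h3'⟩ hy
    simp only at hy h3'
    subst hy
    by_cases hb : b = b'
    · subst hb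
      rw [hdet _ _ _ _ ((hd _ _ _).1 h1) ((hd _ _ _).1 h1')]
    · exact absurd (goodEdge_of_succ ((hd _ _ _).1 h1')
        (fun h => hb (inv_injective h).symm) h3') h2
  have hfin : Finite S := Finite.of_injective (fun e : S => e.1.2.2)
    (fun e e' h => Subtype.ext (hinj _ e.2 _ e'.2 h))
  have hsucc : ∀ e : S, ∃ f : S, f.1.1 = e.1.2.2 := by
    rintro ⟨⟨x, b, y⟩, h1, h2, h3⟩
    have hy : y ≠ M.q0 := by
      rintro rfl
      exact h2 ⟨[], List.isChain_singleton _, Path.nil _⟩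
    obtain ⟨c, r, hc, hcb⟩ := exists_succ hd hdet hno h1 hy
    refine ⟨⟨(y, c, r), hc, fun h => h2 (goodEdge_of_succ hc hcb h), ?_⟩, rfl⟩
    refine goodEdge_of_succ ((hd _ _ _).1 h1) ?_ h3
    rw [inv_inv']
    intro h
    exact hcb h.symm
  choose f hf using hsucc
  have finj : Injective f := by
    intro e e' h
    have : e.1.2.2 = e'.1.2.2 := by rw [← hf, ← hf, h]
    exact Subtype.ext (hinj _ e.2 _ e'.2 this)
  have fsurj : Surjective f := Finite.surjective_of_injective finj
  have key : ∀ (w : List (Ltr A)) (g : S),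
      List.IsChain (fun x y => y ≠ Ltr.inv x) (Ltr.inv g.1.2.1 :: w) →
      M.Path g.1.1 w M.q0 → False := by
    intro w
    induction w with
    | nil =>
      intro g _ hp
      rw [path_nil_iff] at hp
      obtain ⟨e, rfl⟩ := fsurj g
      rw [hf] at hp
      exact e.2.2.1 ⟨[], List.isChain_singleton _, path_nil_iff.2 hp⟩
    | cons b w ih =>
      intro g hch hp
      obtain ⟨e, rfl⟩ := fsurj g
      rw [hf] at hp
      obtain ⟨r, h1, h2⟩ := path_cons_iff.1 hp
      have hch' := (List.isChain_cons_cons.1 hch).2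
      obtain ⟨⟨x, c, y⟩, e1, e2, e3⟩ := e
      simp only at h1
      by_cases hb : b = Ltr.inv c
      · subst hb
        have hr : r = x := hdet _ _ _ _ h1 ((hd _ _ _).1 e1)
        subst hr
        exact ih ⟨(r, c, y), e1, e2, e3⟩ hch' h2
      · exact e2 (goodEdge_of_succ h1 hb ⟨w, hch', h2⟩)
  obtain ⟨w, h1, h2⟩ := hg
  exact key w ⟨(p, a, q), he, hbad, ⟨w, h1, h2⟩⟩ h1 h2

theorem exists_reduced_path {M : Autom A} (hd : M.Dual) (hdet : M.Deterministic) :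
    ∀ (k : ℕ) (u : List (Ltr A)), u.length = k → ∀ p q, M.Path p u q →
      ∃ v, IsReducedWord v ∧ M.Path p v q := by
  intro k
  induction k using Nat.strong_induction_on with
  | _ k ih =>
    intro u hk p q hp
    by_cases hr : IsReducedWord u
    · exact ⟨u, hr, hp⟩
    · unfold IsReducedWord at hr
      push Not at hr
      obtain ⟨x, y, a, b, rfl⟩ := hr
      obtain ⟨s, h1, h2⟩ := path_append_iff.1 hp
      obtain ⟨t, h3, h4⟩ := path_cons_iff.1 h2
      obtain ⟨s', h5, h6⟩ := path_cons_iff.1 h4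
      have : s' = s := hdet _ _ _ _ h5 ((hd _ _ _).1 h3)
      subst this
      exact ih (x ++ y).length (by simp at hk ⊢; omega) _ rfl p q
        (path_append_iff.2 ⟨_, h1, h6⟩)

theorem wordInv_chain {w : List (Ltr A)} (h : List.IsChain (fun x y => y ≠ Ltr.inv x) w) :
    List.IsChain (fun x y => y ≠ Ltr.inv x) (wordInv w) := by
  unfold wordInv
  rw [List.isChain_reverse, List.isChain_map]
  refine h.imp ?_
  intro a b hab h'
  rw [inv_inv'] at h'
  exact hab h'.symm

theorem isRed_of_noRed2 {M : Autom A} [Finite M.Q] (hd : M.Dual) (hdet : M.Deterministic)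
    (hconn : ∀ q, ∃ u, M.Path M.q0 u q) (hno : ∀ N, ¬ Red2 M N) : M.IsRed := by
  intro q
  obtain ⟨u₀, hu₀⟩ := hconn q
  obtain ⟨u, hur, hu⟩ := exists_reduced_path hd hdet _ u₀ rfl _ _ hu₀
  rcases List.eq_nil_or_concat u with rfl | ⟨u', a, rfl⟩
  · rw [path_nil_iff] at hu
    subst hu
    exact ⟨[], [], hur, Path.nil _, Path.nil _⟩
  · rw [isReducedWord_iff] at hur
    simp only [List.concat_eq_append] at *
    obtain ⟨p, h1, h2⟩ := path_append_iff.1 hu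
    obtain ⟨s, h3, h4⟩ := path_cons_iff.1 h2
    rw [path_nil_iff] at h4
    subst h4
    have hg : M.GoodEdge (s, Ltr.inv a, p) := by
      refine ⟨wordInv u', ?_, path_inv hd h1⟩
      have := wordInv_chain hur
      simpa [wordInv] using this
    obtain ⟨w, hw1, hw2⟩ := goodEdge_of_inv hd hdet hno h3 hg
    refine ⟨u' ++ [a], w, ?_, hu, hw2⟩
    rw [isReducedWord_iff]
    simp only at hw1
    rw [List.append_assoc]
    exact List.IsChain.append_overlap (l₂ := [a]) hur hw1 (by simp) |> fun h => by simpa using h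

/-! Expansions -/

/-- The states of the path added by an expansion at the initial state. -/
def expandC (M : Autom A) (w : List (Ltr A)) (i : ℕ) : M.Q ⊕ Fin (w.length - 1) :=
  if h : 0 < i ∧ i < w.length then Sum.inr ⟨i - 1, by omega⟩ else Sum.inl M.q0

/-- The concrete expansion by `(q₀, w, q₀)`. -/
abbrev expand (M : Autom A) (w : List (Ltr A)) : Autom A where
  Q := M.Q ⊕ Fin (w.length - 1)
  q0 := Sum.inl M.q0
  E := {e | (∃ e' ∈ M.E, e = (Sum.inl e'.1, e'.2.1, Sum.inl e'.2.2)) ∨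
    ∃ i : Fin w.length,
      e = (expandC M w i, w.get i, expandC M w (i + 1)) ∨
      e = (expandC M w (i + 1), Ltr.inv (w.get i), expandC M w i)}

theorem expandC_zero (M : Autom A) (w : List (Ltr A)) : expandC M w 0 = Sum.inl M.q0 := by
  simp [expandC]

theorem expandC_length (M : Autom A) (w : List (Ltr A)) :
    expandC M w w.length = Sum.inl M.q0 := by
  simp [expandC]

theorem expandC_succ (M : Autom A) (w : List (Ltr A)) (i : Fin (w.length - 1)) :
    expandC M w (i + 1) = Sum.inr i := by
  have := i.2
  unfold expandC
  rw [dif_pos (by omega)]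
  rfl

theorem isExpansion_expand (M : Autom A) (w : List (Ltr A)) (hw : w ≠ []) :
    M.IsExpansion M.q0 w M.q0 (expand M w) := by
  refine ⟨hw, Sum.inl, fun i => expandC M w i, Sum.inl_injective, rfl, expandC_zero M w,
    expandC_length M w, ?_, ?_, ?_, ?_⟩
  · rintro i h1 h2 ⟨y, hy⟩
    simp [expandC, h1, h2] at hy
  · intro i j h1 h2 hij
    by_cases hj : 0 < (j : ℕ) ∧ (j : ℕ) < w.length
    · simp only [expandC] at hij
      rw [dif_pos ⟨h1, h2⟩, dif_pos hj] at hij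
      have := congrArg Fin.val (Sum.inr_injective hij)
      simp only at this
      ext; omega
    · simp only [expandC] at hij
      rw [dif_pos ⟨h1, h2⟩, dif_neg hj] at hij
      cases hij
  · rintro (x | i)
    · exact Or.inl ⟨x, rfl⟩
    · right
      have := i.2
      exact ⟨⟨i + 1, by omega⟩, expandC_succ M w i⟩
  · intro e
    rfl

theorem expand_inl_path (M : Autom A) (w : List (Ltr A)) {u : List (Ltr A)} {p q : M.Q}
    (h : M.Path p u q) : (expand M w).Path (Sum.inl p) u (Sum.inl q) :=
  path_map (N := expand M w) Sum.inl (fun _ _ _ h => Or.inl ⟨_, h, rfl⟩) h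

theorem expand_take_path (M : Autom A) (w : List (Ltr A)) : ∀ i ≤ w.length,
    (expand M w).Path (expand M w).q0 (w.take i) (expandC M w i) := by
  intro i
  induction i with
  | zero => intro _; rw [expandC_zero]; exact Path.nil _
  | succ i ih =>
    intro hi
    rw [List.take_succ_eq_append_getElem (by omega), path_append_iff]
    refine ⟨_, ih (by omega), path_cons_iff.2 ⟨_, ?_, Path.nil _⟩⟩
    exact Or.inr ⟨⟨i, by omega⟩, Or.inl rfl⟩

theorem expand_loop (M : Autom A) (w : List (Ltr A)) : w ∈ (expand M w).lang := by
  have := expand_take_path M w w.length le_rfl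
  rw [expandC_length, List.take_length] at this
  exact this

theorem expand_good {H : Subgroup (FreeGroup A)} {M : Autom A} {w : List (Ltr A)}
    (h : Good H M) (hw : FreeGroup.mk w ∈ H) : Good H (expand M w) := by
  refine ⟨?_, ?_, ?_, ?_⟩
  · have aux : ∀ x b y, (x, b, y) ∈ (expand M w).E → (y, Ltr.inv b, x) ∈ (expand M w).E := by
      rintro x b y (⟨⟨x', b', y'⟩, he, heq⟩ | ⟨i, heq | heq⟩)
      · simp only [Prod.mk.injEq] at heq
        obtain ⟨rfl, rfl, rfl⟩ := heq
        exact Or.inl ⟨_, (h.dual _ _ _).1 he, rfl⟩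
      · simp only [Prod.mk.injEq] at heq
        obtain ⟨rfl, rfl, rfl⟩ := heq
        exact Or.inr ⟨i, Or.inr rfl⟩
      · simp only [Prod.mk.injEq] at heq
        obtain ⟨rfl, rfl, rfl⟩ := heq
        rw [inv_inv']
        exact Or.inr ⟨i, Or.inl rfl⟩
    intro x b y
    exact ⟨aux _ _ _, fun h => by have := aux _ _ _ h; rwa [inv_inv'] at this⟩
  · rintro (x | i)
    · obtain ⟨u, hu⟩ := h.conn x
      exact ⟨u, expand_inl_path M w hu⟩
    · have := i.2
      have hp := expand_take_path M w (i + 1) (by omega)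
      rw [expandC_succ] at hp
      exact ⟨_, hp⟩
  · have := h.fin
    exact inferInstanceAs (Finite (M.Q ⊕ Fin (w.length - 1)))
  · obtain ⟨τ, t0, hτ⟩ := h.tau
    let τ' : M.Q ⊕ Fin (w.length - 1) → FreeGroup A ⧸ H := Sum.elim τ
      (fun i => (((FreeGroup.mk (w.take (i + 1)))⁻¹ : FreeGroup A) : FreeGroup A ⧸ H))
    have hc : ∀ i ≤ w.length, τ' (expandC M w i) =
        (((FreeGroup.mk (w.take i))⁻¹ : FreeGroup A) : FreeGroup A ⧸ H) := by
      intro i hi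
      rcases Nat.eq_zero_or_pos i with rfl | hpos
      · rw [expandC_zero, List.take_zero, ← FreeGroup.one_eq_mk, inv_one]
        exact t0
      · rcases Nat.lt_or_eq_of_le hi with hlt | rfl
        · have := expandC_succ M w ⟨i - 1, by omega⟩
          have hi' : i - 1 + 1 = i := by omega
          simp only [hi'] at this
          rw [this]
          change (((FreeGroup.mk (w.take (i - 1 + 1)))⁻¹ : FreeGroup A) : FreeGroup A ⧸ H) = _
          rw [hi']
        · rw [expandC_length, List.take_length]
          change τ M.q0 = _
          rw [t0, QuotientGroup.eq]
          rw [inv_one, one_mul, inv_mem_iff]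
          exact hw
    refine ⟨τ', t0, ?_⟩
    have hstep : ∀ i : Fin w.length, τ' (expandC M w (i + 1)) =
        (FreeGroup.mk [w.get i])⁻¹ • τ' (expandC M w i) := by
      intro i
      have := i.2
      rw [hc _ (by omega), hc _ (by omega), List.take_succ_eq_append_getElem (by omega),
        ← FreeGroup.mul_mk, mul_inv_rev]
      rfl
    rintro x b y (⟨⟨x', b', y'⟩, he, heq⟩ | ⟨i, heq | heq⟩)
    · simp only [Prod.mk.injEq] at heq
      obtain ⟨rfl, rfl, rfl⟩ := heq
      exact hτ _ _ _ he
    · simp only [Prod.mk.injEq] at heq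
      obtain ⟨rfl, rfl, rfl⟩ := heq
      exact hstep i
    · simp only [Prod.mk.injEq] at heq
      obtain ⟨rfl, rfl, rfl⟩ := heq
      have e1 : FreeGroup.mk [Ltr.inv (w.get i)] = (FreeGroup.mk [w.get i])⁻¹ :=
        mk_wordInv [w.get i]
      rw [e1, inv_inv, hstep i, smul_inv_smul]

theorem expand_langRho (M : Autom A) (w : List (Ltr A)) :
    M.langRho ⊆ (expand M w).langRho := by
  rintro _ ⟨u, hu, rfl⟩
  exact ⟨u, expand_inl_path M w hu, rfl⟩

/-- Successive expansions at the initial state, from the one-state automaton. -/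
def expandSeq (f : ℕ → List (Ltr A)) : ℕ → Autom A
  | 0 => ⟨Unit, (), ∅⟩
  | k + 1 => expand (expandSeq f k) (f k)

theorem expandSeq_good {H : Subgroup (FreeGroup A)} (f : ℕ → List (Ltr A)) :
    ∀ k, (∀ i < k, FreeGroup.mk (f i) ∈ H) → Good H (expandSeq f k) := by
  intro k
  induction k with
  | zero =>
    intro _
    refine ⟨fun _ _ _ => Iff.rfl, fun q => ⟨[], Path.nil _⟩,
      inferInstanceAs (Finite Unit), fun _ => ((1 : FreeGroup A) : FreeGroup A ⧸ H), rfl, ?_⟩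
    intro p a q he
    exact absurd he (Set.notMem_empty _)
  | succ k ih =>
    intro hk
    exact expand_good (ih fun i hi => hk i (by omega)) (hk k (by omega))

theorem expandSeq_langRho (f : ℕ → List (Ltr A)) :
    ∀ k, ∀ i < k, FreeGroup.mk (f i) ∈ (expandSeq f k).langRho := by
  intro k
  induction k with
  | zero => intro i hi; omega
  | succ k ih =>
    intro i hi
    rcases Nat.lt_succ_iff_lt_or_eq.1 hi with h | rfl
    · exact expand_langRho _ _ (ih i h)
    · exact ⟨f i, expand_loop _ _, rfl⟩

theorem expandSeq_card (f : ℕ → List (Ltr A)) :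
    ∀ k, (∀ i < k, f i ≠ []) → Finite (expandSeq f k).Q ∧
      Nat.card (expandSeq f k).Q + k = ∑ i ∈ Finset.range k, (f i).length + 1 := by
  intro k
  induction k with
  | zero =>
    intro _
    exact ⟨inferInstanceAs (Finite Unit), by simp [expandSeq]⟩
  | succ k ih =>
    intro hk
    obtain ⟨h1, h2⟩ := ih fun i hi => hk i (by omega)
    have hpos := List.length_pos_iff.2 (hk k (by omega))
    refine ⟨inferInstanceAs (Finite ((expandSeq f k).Q ⊕ Fin ((f k).length - 1))), ?_⟩
    have : Nat.card (expandSeq f (k + 1)).Q =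
        Nat.card (expandSeq f k).Q + ((f k).length - 1) := by
      change Nat.card ((expandSeq f k).Q ⊕ Fin ((f k).length - 1)) = _
      rw [Nat.card_sum, Nat.card_fin]
    rw [this, Finset.sum_range_succ]
    omega

end Autom

/-- Construction of the graph representation: starting from the one-state automaton and
performing the expansions by `(q₀, hᵢ, q₀)` and then reducing, one obtains a reduced
inverse automaton representing `H = ⟨h₁, …, hₙ⟩`, with at most `ℓ - n + 1` states. -/
theorem graph_representation_exists
    {A : Type} (n : ℕ) (hn : 1 ≤ n)
    (h : Fin n → List (Ltr A)) (hne : ∀ i, h i ≠ []) (hred : ∀ i, IsReducedWord (h i))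
    (H : Subgroup (FreeGroup A))
    (hH : H = Subgroup.closure (Set.range fun i => FreeGroup.mk (h i))) :
    ∃ (M : Fin (n + 1) → Autom A) (B : Autom A),
      M 0 = ⟨Unit, (), ∅⟩ ∧
      (∀ i : Fin n,
        (M i.castSucc).IsExpansion (M i.castSucc).q0 (h i) (M i.castSucc).q0 (M i.succ)) ∧
      Autom.ReductionOf (M (Fin.last n)) B ∧
      B.IsInv ∧ B.IsRed ∧ B.langRho = ↑H ∧
      Nat.card B.Q ≤ (∑ i, (h i).length) - n + 1 := by
  classical
  let f : ℕ → List (Ltr A) := fun k => if hk : k < n then h ⟨k, hk⟩ else []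
  have hf : ∀ i : Fin n, f i = h i := fun i => by simp [f]
  have hfne : ∀ i < n, f i ≠ [] := fun i hi => by
    have := hf ⟨i, hi⟩
    simp only at this
    rw [this]; exact hne _
  have hfH : ∀ i < n, FreeGroup.mk (f i) ∈ H := fun i hi => by
    have := hf ⟨i, hi⟩
    simp only at this
    rw [this, hH]
    exact Subgroup.subset_closure ⟨⟨i, hi⟩, rfl⟩
  have hgood := Autom.expandSeq_good (H := H) f n hfH
  obtain ⟨M₁, r1, d1, g1, l1, c1⟩ := Autom.exists_det _ _ rfl hgood
  obtain ⟨B, r2, d2, g2, l2, c2, hno⟩ := Autom.exists_core _ _ rfl g1 d1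
  refine ⟨fun i => Autom.expandSeq f i, B, rfl, ?_, ⟨M₁, r1, d1, r2, hno⟩,
    ⟨d2, g2.trim, g2.dual⟩, ?_, ?_, ?_⟩
  · intro i
    have := Autom.isExpansion_expand (Autom.expandSeq f i) (f i) (hfne i i.2)
    rw [hf] at this
    have e : Autom.expandSeq f (i.succ : Fin (n + 1)) = Autom.expand (Autom.expandSeq f i) (h i) := by
      rw [← hf]; rfl
    simp only [Fin.val_castSucc]
    rw [e]
    exact this
  · have := g2.fin
    exact Autom.isRed_of_noRed2 g2.dual d2 g2.conn hno
  · refine Set.Subset.antisymm g2.langRho_subset ?_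
    rw [hH]
    refine Autom.langRho_closure g2.dual ?_
    rintro _ ⟨i, rfl⟩
    apply l2
    apply l1
    have := Autom.expandSeq_langRho f n i i.2
    rwa [hf] at this
  · have hc := (Autom.expandSeq_card f n hfne).2
    rw [Finset.sum_range] at hc
    simp only [hf] at hc
    omega
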